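/- (Lemma 3.2: recurrence coefficients in terms of the auxiliary quantities.) For every integer n ≥ 0: α_n = (1/2)·Σ_{j=1}^N R_{n,j}, and β_n = (1/2)·n + (1/2)·Σ_{j=1}^N r_{n,j}. -/

import Mathlib

open MeasureTheory Polynomial

section GeneralizedHermite

open Filter Topology

variable {ι : Type*} [Fintype ι]

/-- The Gaussian weight `exp (-x ^ 2)` multiplied by the factors `|x - t i| ^ γ i`. -/
noncomputable def gaussianRpowWeight (t γ : ι → ℝ) (x : ℝ) : ℝ :=
  Real.exp (-x ^ 2) * ∏ i, |x - t i| ^ γ i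

theorem Polynomial.integrable_eval_mul_exp_neg_sq (q : ℝ[X]) :
    Integrable fun x : ℝ => q.eval x * Real.exp (-x ^ 2) := by
  induction q using Polynomial.induction_on' with
  | add p q hp hq =>
    simp only [eval_add, add_mul]
    exact hp.add hq
  | monomial n a =>
    have hn : (-1 : ℝ) < n := by have := n.cast_nonneg (α := ℝ); linarith
    have := (integrable_rpow_mul_exp_neg_mul_sq one_pos hn).const_mul a
    simpa [mul_assoc] using this

theorem Polynomial.tendsto_eval_mul_exp_neg_sq (q : ℝ[X]) :
    Tendsto (fun x : ℝ => q.eval x * Real.exp (-x ^ 2)) (cocompact ℝ) (𝓝 0) := by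
  induction q using Polynomial.induction_on' with
  | add p q hp hq => simpa [add_mul] using hp.add hq
  | monomial n a =>
    have := (tendsto_rpow_abs_mul_exp_neg_mul_sq_cocompact one_pos n).const_mul |a|
    rw [mul_zero] at this
    refine squeeze_zero_norm (fun x => le_of_eq ?_) this
    simp [mul_assoc]

theorem Real.abs_rpow_le_one_add_pow (x : ℝ) {a : ℝ} (ha : 0 ≤ a) :
    |x| ^ a ≤ 1 + x ^ (2 * ⌈a⌉₊) := by
  have hpow : x ^ (2 * ⌈a⌉₊) = |x| ^ (2 * ⌈a⌉₊) := by rw [pow_mul, pow_mul, sq_abs]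
  rw [hpow]
  rcases le_total |x| 1 with hx | hx
  · have := Real.rpow_le_one (abs_nonneg x) hx ha
    have := pow_nonneg (abs_nonneg x) (2 * ⌈a⌉₊)
    linarith
  · have hle : a ≤ ((2 * ⌈a⌉₊ : ℕ) : ℝ) := by
      have := Nat.le_ceil a
      push_cast
      linarith
    have := Real.rpow_le_rpow_of_exponent_le hx hle
    rw [Real.rpow_natCast] at this
    linarith

/-- A polynomial multiple of the weight is dominated by a polynomial multiple of the Gaussian. -/
theorem exists_norm_eval_mul_gaussianRpowWeight_le (t : ι → ℝ) {γ : ι → ℝ} (hγ : ∀ i, 0 < γ i)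
    (q : ℝ[X]) : ∃ p : ℝ[X], ∀ x : ℝ,
      ‖q.eval x * gaussianRpowWeight t γ x‖ ≤ ‖p.eval x * Real.exp (-x ^ 2)‖ := by
  refine ⟨q * ∏ i, (1 + (X - C (t i)) ^ (2 * ⌈γ i⌉₊)), fun x => ?_⟩
  have hle : ∏ i, |x - t i| ^ γ i ≤ ∏ i, (1 + (x - t i) ^ (2 * ⌈γ i⌉₊)) :=
    Finset.prod_le_prod (fun i _ => Real.rpow_nonneg (abs_nonneg _) _)
      fun i _ => Real.abs_rpow_le_one_add_pow _ (hγ i).le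
  have h0 : 0 ≤ ∏ i, |x - t i| ^ γ i :=
    Finset.prod_nonneg fun i _ => Real.rpow_nonneg (abs_nonneg _) _
  simp only [gaussianRpowWeight, eval_mul, eval_prod, eval_add, eval_one, eval_pow, eval_sub,
    eval_X, eval_C, norm_mul]
  rw [mul_assoc, mul_comm ‖Real.exp _‖, Real.norm_of_nonneg h0,
    Real.norm_of_nonneg (h0.trans hle)]
  gcongr

theorem continuous_gaussianRpowWeight (t : ι → ℝ) {γ : ι → ℝ} (hγ : ∀ i, 0 < γ i) :
    Continuous (gaussianRpowWeight t γ) := by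
  unfold gaussianRpowWeight
  refine (by fun_prop : Continuous fun x : ℝ => Real.exp (-x ^ 2)).mul
    (continuous_finsetProd _ fun i _ => ?_)
  exact (by fun_prop : Continuous fun x : ℝ => |x - t i|).rpow_const fun _ => Or.inr (hγ i).le

theorem integrable_eval_mul_gaussianRpowWeight (t : ι → ℝ) {γ : ι → ℝ} (hγ : ∀ i, 0 < γ i)
    (q : ℝ[X]) : Integrable fun x : ℝ => q.eval x * gaussianRpowWeight t γ x := by
  obtain ⟨p, hp⟩ := exists_norm_eval_mul_gaussianRpowWeight_le t hγ q
  exact p.integrable_eval_mul_exp_neg_sq.norm.mono'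
    (q.continuous.mul (continuous_gaussianRpowWeight t hγ)).aestronglyMeasurable
    (Eventually.of_forall hp)

theorem tendsto_eval_mul_gaussianRpowWeight (t : ι → ℝ) {γ : ι → ℝ} (hγ : ∀ i, 0 < γ i)
    (q : ℝ[X]) :
    Tendsto (fun x : ℝ => q.eval x * gaussianRpowWeight t γ x) (cocompact ℝ) (𝓝 0) := by
  obtain ⟨p, hp⟩ := exists_norm_eval_mul_gaussianRpowWeight_le t hγ q
  exact squeeze_zero_norm hp (tendsto_zero_iff_norm_tendsto_zero.1 p.tendsto_eval_mul_exp_neg_sq)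

theorem integrableOn_abs_sub_rpow_div_sub (a : ℝ) {s : ℝ} (hs : 0 < s) :
    IntegrableOn (fun x : ℝ => |x - a| ^ s / (x - a)) (Set.Icc (a - 1) (a + 1)) := by
  have hint : IntervalIntegrable (fun x : ℝ => |x - a| ^ (s - 1)) volume (a - 1) (a + 1) := by
    have h01 : IntervalIntegrable (fun x : ℝ => |x| ^ (s - 1)) volume 0 1 := by
      refine (intervalIntegral.intervalIntegrable_rpow' (by linarith : -1 < s - 1)).congr ?_
      intro x hx
      rw [Set.uIoc_of_le zero_le_one] at hx
      simp only [abs_of_pos hx.1]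
    have h10 : IntervalIntegrable (fun x : ℝ => |x| ^ (s - 1)) volume (-1) 0 := by
      simpa using (h01.comp_sub_left 0).symm
    simpa [sub_eq_add_neg, add_comm] using (h10.trans h01).comp_sub_right a
  rw [intervalIntegrable_iff_integrableOn_Icc_of_le (by linarith)] at hint
  have hmeas : Measurable fun x : ℝ => |x - a| ^ s / (x - a) :=
    (by fun_prop : Measurable fun x : ℝ => |x - a| ^ s).div (by fun_prop)
  refine hint.norm.mono' hmeas.aestronglyMeasurable (Eventually.of_forall fun x => ?_)
  rcases eq_or_ne (x - a) 0 with hx | hx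
  · simp [hx]
  · rw [Real.rpow_sub_one (abs_ne_zero.2 hx), norm_div, norm_div]
    simp

theorem integrable_eval_mul_gaussianRpowWeight_div (t : ι → ℝ) {γ : ι → ℝ} (hγ : ∀ i, 0 < γ i)
    (q : ℝ[X]) (j : ι) :
    Integrable fun x : ℝ => q.eval x * gaussianRpowWeight t γ x / (x - t j) := by
  classical
  have hq := integrable_eval_mul_gaussianRpowWeight t hγ q
  rw [← integrableOn_univ, ← Set.union_compl_self (Set.Icc (t j - 1) (t j + 1))]
  refine IntegrableOn.union ?_ ?_
  · have hcont : Continuous fun x : ℝ =>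
        q.eval x * (Real.exp (-x ^ 2) * ∏ i ∈ Finset.univ.erase j, |x - t i| ^ γ i) := by
      refine q.continuous.mul ((by fun_prop : Continuous fun x : ℝ => Real.exp (-x ^ 2)).mul
        (continuous_finsetProd _ fun i _ => ?_))
      exact (by fun_prop : Continuous fun x : ℝ => |x - t i|).rpow_const
        fun _ => Or.inr (hγ i).le
    refine ((integrableOn_abs_sub_rpow_div_sub (t j) (hγ j)).continuousOn_mul
      hcont.continuousOn isCompact_Icc).congr_fun (fun x _ => ?_) measurableSet_Icc
    simp only [gaussianRpowWeight]
    rw [← Finset.mul_prod_erase _ _ (Finset.mem_univ j)]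
    ring
  · refine hq.integrableOn.norm.mono'
      (hq.aestronglyMeasurable.restrict.div₀ (by fun_prop)) ?_
    filter_upwards [ae_restrict_mem measurableSet_Icc.compl] with x hx
    rw [norm_div]
    refine div_le_self (norm_nonneg _) ?_
    by_contra! hlt
    rw [Real.norm_eq_abs, abs_lt] at hlt
    exact hx ⟨by linarith, by linarith⟩

theorem hasDerivAt_abs_sub_rpow (a s : ℝ) {x : ℝ} (hx : x ≠ a) :
    HasDerivAt (fun y : ℝ => |y - a| ^ s) (s * |x - a| ^ s / (x - a)) x := by
  have hxa : x - a ≠ 0 := sub_ne_zero.2 hx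
  have hd := ((hasDerivAt_abs hxa).comp_sub_const x a).rpow_const (p := s)
    (Or.inl (abs_ne_zero.2 hxa))
  convert hd using 1
  rw [Real.rpow_sub_one (abs_ne_zero.2 hxa)]
  rcases hxa.lt_or_gt with hneg | hpos
  · rw [sign_neg hneg, abs_of_neg hneg, SignType.coe_neg_one]
    field_simp
  · rw [sign_pos hpos, abs_of_pos hpos, SignType.coe_one]
    field_simp

theorem hasDerivAt_gaussianRpowWeight (t γ : ι → ℝ) {x : ℝ} (hx : ∀ i, x ≠ t i) :
    HasDerivAt (gaussianRpowWeight t γ)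
      (gaussianRpowWeight t γ x * (-2 * x + ∑ i, γ i / (x - t i))) x := by
  classical
  have hexp : HasDerivAt (fun y : ℝ => Real.exp (-y ^ 2)) (Real.exp (-x ^ 2) * (-(2 * x))) x := by
    simpa using ((hasDerivAt_pow 2 x).neg).exp
  have hprod := HasDerivAt.fun_finsetProd (u := Finset.univ)
    fun i _ => hasDerivAt_abs_sub_rpow (t i) (γ i) (hx i)
  refine (hexp.mul hprod).congr_deriv ?_
  have hterm : ∀ i, (∏ k ∈ Finset.univ.erase i, |x - t k| ^ γ k) • (γ i * |x - t i| ^ γ i / (x - t i))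
      = (∏ k, |x - t k| ^ γ k) * (γ i / (x - t i)) := fun i => by
    rw [← Finset.mul_prod_erase _ _ (Finset.mem_univ i), smul_eq_mul]
    ring
  simp only [hterm, ← Finset.mul_sum, gaussianRpowWeight]
  ring

/-- Integration by parts for a polynomial against the derivative of the weight. -/
theorem integral_derivative_mul_gaussianRpowWeight (t : ι → ℝ) {γ : ι → ℝ} (hγ : ∀ i, 0 < γ i)
    (q : ℝ[X]) :
    2 * ∫ x : ℝ, (X * q).eval x * gaussianRpowWeight t γ x =
      (∫ x : ℝ, q.derivative.eval x * gaussianRpowWeight t γ x) +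
        ∑ i, γ i * ∫ x : ℝ, q.eval x * gaussianRpowWeight t γ x / (x - t i) := by
  set W := gaussianRpowWeight t γ
  let f' : ℝ → ℝ := fun x => q.derivative.eval x * W x - 2 * ((X * q).eval x * W x) +
    ∑ i, γ i * (q.eval x * W x / (x - t i))
  have hi₁ : Integrable fun x : ℝ => q.derivative.eval x * W x :=
    integrable_eval_mul_gaussianRpowWeight t hγ _
  have hi₂ : Integrable fun x : ℝ => 2 * ((X * q).eval x * W x) :=
    (integrable_eval_mul_gaussianRpowWeight t hγ _).const_mul 2
  have hi₃ : ∀ i ∈ Finset.univ, Integrable fun x : ℝ => γ i * (q.eval x * W x / (x - t i)) :=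
    fun i _ => (integrable_eval_mul_gaussianRpowWeight_div t hγ q i).const_mul _
  have hf' : Integrable f' := (hi₁.sub hi₂).add (integrable_finsetSum _ hi₃)
  have hderiv : ∀ x ∉ Set.range t, HasDerivAt (fun x => q.eval x * W x) (f' x) x := by
    intro x hx
    refine ((q.hasDerivAt x).mul
      (hasDerivAt_gaussianRpowWeight t γ fun i hi => hx ⟨i, hi.symm⟩)).congr_deriv ?_
    have hsum : ∑ i, γ i * (q.eval x * W x / (x - t i)) =
        q.eval x * W x * ∑ i, γ i / (x - t i) := by
      rw [Finset.mul_sum]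
      exact Finset.sum_congr rfl fun i _ => by ring
    simp only [f', hsum, eval_mul, eval_X]
    ring
  have hftc : ∀ T : ℝ, 0 ≤ T → ∫ x in (-T)..T, f' x = q.eval T * W T - q.eval (-T) * W (-T) :=
    fun T hT => integral_eq_of_hasDerivAt_off_countable_of_le _ _ (by linarith)
      (Set.finite_range t).countable
      (q.continuous.mul (continuous_gaussianRpowWeight t hγ)).continuousOn
      (fun x hx => hderiv x hx.2) hf'.intervalIntegrable
  have hlim := intervalIntegral_tendsto_integral hf' tendsto_neg_atTop_atBot tendsto_id
  have hzero := tendsto_eval_mul_gaussianRpowWeight t hγ q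
  rw [cocompact_eq_atBot_atTop, tendsto_sup] at hzero
  have hlim' := (hzero.2.sub (hzero.1.comp tendsto_neg_atTop_atBot)).congr'
    ((eventually_ge_atTop 0).mono fun T hT => (hftc T hT).symm)
  have hint : ∫ x, f' x = 0 := by simpa using tendsto_nhds_unique hlim hlim'
  have hsplit : ∫ x, f' x = _ :=
    integral_add (hi₁.sub hi₂) (integrable_finsetSum _ hi₃)
  rw [hint, integral_sub hi₁ hi₂, integral_finsetSum _ hi₃] at hsplit
  simp only [integral_const_mul] at hsplit
  linarith

end GeneralizedHermite

section OrthogonalPolynomials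

variable {R : Type*} [CommRing R] {P : ℕ → R[X]} (L : R[X] →ₗ[R] R)

/-- Members of a monic orthogonal family annihilate polynomials of smaller degree. -/
theorem Polynomial.orthogonal_of_degree_lt (hmonic : ∀ n, (P n).Monic)
    (hdeg : ∀ n, (P n).natDegree = n) (horth : ∀ m n, m ≠ n → L (P m * P n) = 0) (n : ℕ) :
    ∀ m ≤ n, ∀ q : R[X], q.degree < m → L (P n * q) = 0 := by
  intro m
  induction m with
  | zero =>
    intro _ q hq
    rw [Nat.cast_zero, ← not_le, zero_le_degree_iff, not_not] at hq
    simp [hq]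
  | succ m ih =>
    intro hm q hq
    have hsub : (q - C (q.coeff m) * P m).degree < m := by
      rw [degree_lt_iff_coeff_zero] at hq ⊢
      intro k hk
      rcases hk.eq_or_lt with rfl | hk
      · have := (hmonic m).coeff_natDegree
        rw [hdeg] at this
        simp [this]
      · rw [coeff_sub, coeff_C_mul, hq k hk,
          coeff_eq_zero_of_natDegree_lt ((hdeg m).trans_lt hk)]
        simp
    have hL := ih (by omega) _ hsub
    rwa [mul_sub, mul_left_comm, C_mul', map_sub, map_smul, horth n m (by omega), smul_zero,
      sub_zero] at hL

/-- Pairing `P n` with a polynomial of degree at most `n` only sees the coefficient of `X ^ n`. -/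
theorem Polynomial.orthogonal_mul_of_natDegree_le (hmonic : ∀ n, (P n).Monic)
    (hdeg : ∀ n, (P n).natDegree = n) (horth : ∀ m n, m ≠ n → L (P m * P n) = 0) (n : ℕ)
    {q : R[X]} (hq : q.natDegree ≤ n) : L (P n * q) = q.coeff n * L (P n ^ 2) := by
  have hsub : (q - C (q.coeff n) * P n).degree < n := by
    rw [degree_lt_iff_coeff_zero]
    intro k hk
    rcases hk.eq_or_lt with rfl | hk
    · have := (hmonic n).coeff_natDegree
      rw [hdeg] at this
      simp [this]
    · rw [coeff_sub, coeff_C_mul, coeff_eq_zero_of_natDegree_lt (hq.trans_lt hk),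
        coeff_eq_zero_of_natDegree_lt ((hdeg n).trans_lt hk)]
      simp
  have hL := orthogonal_of_degree_lt L hmonic hdeg horth n n le_rfl _ hsub
  rw [mul_sub, mul_left_comm, C_mul', map_sub, map_smul, ← sq, smul_eq_mul] at hL
  exact sub_eq_zero.1 hL

end OrthogonalPolynomials

theorem recurrence_coeffs_aux
    (N : ℕ) (hN : 1 ≤ N)
    (t γ : Fin N → ℝ) (ht : Function.Injective t) (hγ : ∀ j, 0 < γ j)
    (w : ℝ → ℝ) (hw : ∀ x : ℝ, w x = Real.exp (-x ^ 2) * ∏ j, |x - t j| ^ γ j)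
    (P : ℕ → Polynomial ℝ)
    (hPmonic : ∀ n, (P n).Monic) (hPdeg : ∀ n, (P n).natDegree = n)
    (horth : ∀ m n, m ≠ n → ∫ x : ℝ, (P m).eval x * (P n).eval x * w x = 0)
    (h : ℕ → ℝ) (hh : ∀ n, h n = ∫ x : ℝ, ((P n).eval x) ^ 2 * w x)
    (hhpos : ∀ n, 0 < h n)
    (β : ℕ → ℝ) (hβ0 : β 0 = 0) (hβ : ∀ n, β (n + 1) = h (n + 1) / h n)
    (α : ℕ → ℝ) (hα : ∀ n, α n = (∫ x : ℝ, x * ((P n).eval x) ^ 2 * w x) / h n)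
    (R : ℕ → Fin N → ℝ)
    (hR : ∀ n j, R n j = γ j / h n * ∫ y : ℝ, ((P n).eval y) ^ 2 * w y / (y - t j))
    (r : ℕ → Fin N → ℝ) (hr0 : ∀ j, r 0 j = 0)
    (hr : ∀ n j, r (n + 1) j = γ j / h n * ∫ y : ℝ, (P (n + 1)).eval y * (P n).eval y * w y / (y - t j))
    (n : ℕ) :
    α n = (1 / 2) * ∑ j, R n j ∧ β n = (n : ℝ) / 2 + (1 / 2) * ∑ j, r n j := by
  obtain rfl : w = gaussianRpowWeight t γ := funext hw
  have hint := integrable_eval_mul_gaussianRpowWeight t hγ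
  let L : ℝ[X] →ₗ[ℝ] ℝ :=
    { toFun := fun q => ∫ x : ℝ, q.eval x * gaussianRpowWeight t γ x
      map_add' := fun p q => by
        simp only [eval_add, add_mul]
        exact integral_add (hint p) (hint q)
      map_smul' := fun c q => by
        simp only [eval_smul, smul_eq_mul, mul_assoc, integral_const_mul, RingHom.id_apply] }
  have hLorth : ∀ m n, m ≠ n → L (P m * P n) = 0 := fun m n hmn => by
    simpa [L] using horth m n hmn
  have hLsq : ∀ n, L (P n ^ 2) = h n := fun n => by simp [L, hh]
  have hpair : ∀ n, ∀ q : ℝ[X], q.natDegree ≤ n → L (P n * q) = q.coeff n * h n :=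
    fun n q hq => by
      rw [orthogonal_mul_of_natDegree_le L hPmonic hPdeg hLorth n hq, hLsq]
  have hparts : ∀ q : ℝ[X], 2 * L (X * q) = L q.derivative +
      ∑ j, γ j * ∫ x : ℝ, q.eval x * gaussianRpowWeight t γ x / (x - t j) :=
    integral_derivative_mul_gaussianRpowWeight t hγ
  have hlead : ∀ n, (P n).coeff n = 1 := fun n => by
    simpa [hPdeg] using (hPmonic n).coeff_natDegree
  have hderivDeg : ∀ n, (P n).derivative.natDegree ≤ n - 1 := fun n =>
    (natDegree_derivative_le (P n)).trans_eq (by rw [hPdeg])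
  have hderivCoeff : ∀ n, (P n).derivative.coeff n = 0 := fun n => by
    rw [coeff_derivative, coeff_eq_zero_of_natDegree_lt (by rw [hPdeg]; omega), zero_mul]
  constructor
  · have hn := (hhpos n).ne'
    have hα' : α n = L (X * P n ^ 2) / h n := by simp [L, hα]
    have hd : L (derivative (P n ^ 2)) = 0 := by
      rw [sq, derivative_mul, mul_comm (derivative _), map_add,
        hpair n _ ((hderivDeg n).trans (Nat.sub_le n 1)), hderivCoeff]
      ring
    have hp := hparts (P n ^ 2)
    simp only [eval_pow] at hp
    simp only [hα', hR, div_mul_eq_mul_div, ← Finset.sum_div]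
    rw [hd, zero_add] at hp
    rw [← hp]
    field_simp
  · cases n with
    | zero => simp [hβ0, hr0]
    | succ n =>
      have hn := (hhpos n).ne'
      have hX : L (X * (P (n + 1) * P n)) = h (n + 1) := by
        rw [mul_left_comm, hpair (n + 1) _ (natDegree_mul_le.trans (by
          rw [hPdeg, natDegree_X]; omega)), coeff_X_mul, hlead, one_mul]
      have hd : L (derivative (P (n + 1) * P n)) = (n + 1) * h n := by
        rw [derivative_mul, mul_comm (derivative _), map_add, hpair n _ (hderivDeg (n + 1)),
          hpair (n + 1) _ ((hderivDeg n).trans (by omega)), coeff_derivative, hlead,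
          coeff_derivative, coeff_eq_zero_of_natDegree_lt (by rw [hPdeg]; omega)]
        ring
      have hp := hparts (P (n + 1) * P n)
      simp only [eval_mul] at hp
      simp only [hβ, hr, div_mul_eq_mul_div, ← Finset.sum_div]
      rw [hX, hd] at hp
      push_cast
      field_simp
      linarith
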